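/- arXiv:1602.06052 — 6 statements merged into one kernel-verified Lean document; each statement's English description precedes it below -/
import Mathlib

section
/- Let ψ and φ be CNF formulas that contain no tautological clauses, and let x be a variable occurring in ψ or φ. If ψ ⊨ φ, then ψ[x_ε] ⊨ φ[x_ε], where the deletion reduct χ[x_ε] of a CNF formula χ removes all occurrences of the literals x and ¬x from all clauses of χ. -/
/-- Propositional variables. -/
abbrev Var := ℕ
/-- A literal is a variable together with a polarity (`true` = positive). -/
abbrev Lit := Var × Bool
/-- A clause is a finite set of literals (their disjunction). -/
abbrev Clause := Finset Lit
/-- A CNF formula is a finite set of clauses (their conjunction). -/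
abbrev CNF := Finset Clause

/-- The complement `∼ℓ` of a literal. -/
def litCompl (l : Lit) : Lit := (l.1, !l.2)

/-- An assignment satisfies a clause if some literal of it is true. -/
def satClause (θ : Var → Bool) (C : Clause) : Prop := ∃ l ∈ C, θ l.1 = l.2

/-- An assignment satisfies a CNF formula if it satisfies every clause. -/
def satCNF (θ : Var → Bool) (φ : CNF) : Prop := ∀ C ∈ φ, satClause θ C

/-- Entailment `φ ⊨ ψ` between CNF formulas. -/
def entails (φ ψ : CNF) : Prop := ∀ θ : Var → Bool, satCNF θ φ → satCNF θ ψ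

/-- Variables of a clause. -/
def varsClause (C : Clause) : Finset Var := C.image Prod.fst

/-- Variables of a CNF formula. -/
def varsCNF (φ : CNF) : Finset Var := φ.sup varsClause

/-- A clause is tautological if it contains `x` and `¬x` for some variable `x`. -/
def tautClause (C : Clause) : Prop := ∃ x : Var, (x, true) ∈ C ∧ (x, false) ∈ C

/-- A CNF formula has no tautological clauses. -/
def noTaut (φ : CNF) : Prop := ∀ C ∈ φ, ¬ tautClause C

/-- An extended literal over variable `x` is `x` (`some true`), `¬x` (`some false`),
or `x_ε` (`none`). -/
abbrev ELit := Var × Option Bool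

/-- The reduct `φ[e]` of a CNF formula by a single extended literal:
for a literal `ℓ` delete every clause containing `ℓ` and remove `∼ℓ` from the rest;
for `x_ε` delete all occurrences of the literals `x` and `¬x` from all clauses. -/
def reduct1 (φ : CNF) (e : ELit) : CNF :=
  match e.2 with
  | some b => (φ.filter (fun C => (e.1, b) ∉ C)).image (fun C => C.erase (e.1, !b))
  | none => φ.image (fun C => (C.erase (e.1, true)).erase (e.1, false))

/-- Successive application of reducts along a list of extended literals. -/
def reductL (φ : CNF) (Y : List ELit) : CNF := Y.foldl reduct1 φ

/-- `Y` represents an element of `tA(X)`: it chooses, for each variable of `X`, exactly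
one of `x`, `¬x`, `x_ε` (the variables of `Y` are pairwise distinct and cover exactly `X`). -/
def isTAList (X : Finset Var) (Y : List ELit) : Prop :=
  (Y.map Prod.fst).Nodup ∧ (Y.map Prod.fst).toFinset = X

/-- `φ'` is a subformula of `φ`: every clause of `φ'` is contained in some clause of `φ`. -/
def subformula (φ' φ : CNF) : Prop := ∀ C' ∈ φ', ∃ C ∈ φ, C' ⊆ C

/-- A class of CNF formulas is clause-induced if it is closed under subformulas. -/
def clauseInduced (Cl : Set CNF) : Prop :=
  ∀ φ ∈ Cl, ∀ φ' : CNF, subformula φ' φ → φ' ∈ Cl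

/-- A monotone CNF formula: only positive literals. -/
def monotoneCNF (φ : CNF) : Prop := ∀ C ∈ φ, ∀ l ∈ C, l.2 = true

/-- A Horn CNF formula: every clause has at most one positive literal. -/
def hornCNF (φ : CNF) : Prop :=
  ∀ C ∈ φ, ∀ l ∈ C, ∀ l' ∈ C, l.2 = true → l'.2 = true → l = l'

/-- A Krom CNF formula: every clause has at most two literals. -/
def kromCNF (φ : CNF) : Prop := ∀ C ∈ φ, C.card ≤ 2

/-- A default rule `α : β / γ`. -/
structure DRule where
  pre : CNF
  just : CNF
  concl : CNF

/-- A default theory `⟨W, D⟩`: a finite set `W` of CNF formulas and a finite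
(ordered, so that the fresh variables `y_i` can be attached) set `D` of default rules. -/
structure DTheory where
  W : Finset CNF
  D : List DRule

/-- `Φ ⊨ ψ` for a set of CNF formulas. -/
def entailsSet (Φ : Set CNF) (ψ : CNF) : Prop :=
  ∀ θ : Var → Bool, (∀ φ ∈ Φ, satCNF θ φ) → satCNF θ ψ

/-- Deductive closure `Th(Φ)`. -/
def Th (Φ : Set CNF) : Set CNF := {ψ | entailsSet Φ ψ}

/-- The justification `β` is not violated by `E`, i.e. `¬β ∉ E` (semantically: `E ⊭ ¬β`,
some assignment satisfies `E` together with `β`). -/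
def notViolated (E : Set CNF) (β : CNF) : Prop :=
  ∃ θ : Var → Bool, (∀ φ ∈ E, satCNF θ φ) ∧ satCNF θ β

/-- `S` satisfies the closure conditions defining `Γ(E)`. -/
def closedFor (T : DTheory) (E S : Set CNF) : Prop :=
  (↑T.W : Set CNF) ⊆ S ∧ Th S = S ∧
    ∀ d ∈ T.D, d.pre ∈ S → notViolated E d.just → d.concl ∈ S

/-- `Γ(E)`: the smallest set `S` with `W ⊆ S`, `Th(S) = S`, closed under applicable defaults. -/
def Gamma (T : DTheory) (E : Set CNF) : Set CNF := ⋂₀ {S : Set CNF | closedFor T E S}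

/-- `E` is a stable extension of `⟨W,D⟩` iff `Γ(E) = E`. -/
def stableExt (T : DTheory) (E : Set CNF) : Prop := Gamma T E = E

/-- A set of formulas is consistent if it is satisfiable. -/
def consistentE (E : Set CNF) : Prop := ∃ θ : Var → Bool, ∀ φ ∈ E, satCNF θ φ

/-- The set of consistent stable extensions of a default theory. -/
def SE (T : DTheory) : Set (Set CNF) := {E | stableExt T E ∧ consistentE E}

/-- Variables of a default rule. -/
def varsRule (d : DRule) : Finset Var := varsCNF d.pre ∪ varsCNF d.just ∪ varsCNF d.concl

/-- Variables of a default theory. -/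
def varsTheory (T : DTheory) : Finset Var :=
  T.W.sup varsCNF ∪ T.D.foldr (fun d s => varsRule d ∪ s) ∅

/-- The formulas occurring in a default theory:
`F = W ∪ {α, β, γ : α:β/γ ∈ D}`. -/
def thForms (T : DTheory) : Set CNF :=
  (↑T.W : Set CNF) ∪ {φ | ∃ d ∈ T.D, φ = d.pre ∨ φ = d.just ∨ φ = d.concl}

/-- Conjoin the fresh positive unit clause `y_i` to a formula. -/
def addY (φ : CNF) (yi : Var) : CNF := φ ∪ {({(yi, true)} : Clause)}

/-- The reduct `⟨W,D⟩[e]` of a default theory by one extended literal, where `y i`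
is the fresh variable attached to the `i`-th default rule. -/
def thReduct1 (y : ℕ → Var) (T : DTheory) (e : ELit) : DTheory :=
  ⟨T.W.image (fun ω => reduct1 ω e),
   T.D.mapIdx (fun i d =>
     ⟨reduct1 d.pre e, reduct1 d.just e, addY (reduct1 d.concl e) (y i)⟩)⟩

/-- Successive application of theory reducts along a list of extended literals. -/
def thReductL (y : ℕ → Var) (T : DTheory) (Y : List ELit) : DTheory :=
  Y.foldl (thReduct1 y) T

/-- `B` is a strong `Cl`-backdoor of `T`: for every `Y ∈ tA(B)`, every formula
occurring in `⟨W,D⟩[Y]` belongs to `Cl`. -/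
def strongBackdoor (y : ℕ → Var) (Cl : Set CNF) (T : DTheory) (B : Finset Var) : Prop :=
  ∀ Y : List ELit, isTAList B Y → ∀ φ ∈ thForms (thReductL y T Y), φ ∈ Cl

/-- The fresh variables `y i` are pairwise distinct and do not occur in `T` nor in `B`. -/
def freshFor (y : ℕ → Var) (T : DTheory) (B : Finset Var) : Prop :=
  Function.Injective y ∧ ∀ i : ℕ, y i ∉ varsTheory T ∪ B

/-- `concl(D,E) = {γ_i : E ⊨ y_i}`. -/
def conclOf (y : ℕ → Var) (D : List DRule) (E : Set CNF) : Set CNF :=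
  {γ | ∃ i : Fin D.length, γ = (D.get i).concl ∧
        entailsSet E {({(y i.1, true)} : Clause)}}

theorem mem_reduct1_none {φ : CNF} {x : Var} {D : Clause} :
    D ∈ reduct1 φ (x, none) ↔ ∃ C ∈ φ, (C.erase (x, true)).erase (x, false) = D :=
  Finset.mem_image

theorem mem_erase_erase {C : Clause} {x : Var} {l : Lit} :
    l ∈ (C.erase (x, true)).erase (x, false) ↔ l ∈ C ∧ l.1 ≠ x := by
  obtain ⟨y, b⟩ := l
  cases b <;> simp [and_comm]

/-- An assignment satisfying the deletion reduct at `x` satisfies the formula, whatever value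
is given to `x`. -/
theorem satCNF_update_of_reduct1_none {ψ : CNF} {x : Var} {θ : Var → Bool} {b : Bool}
    (hθ : satCNF θ (reduct1 ψ (x, none))) : satCNF (Function.update θ x b) ψ := by
  intro C hC
  obtain ⟨l, hl, hval⟩ := hθ _ (mem_reduct1_none.2 ⟨C, hC, rfl⟩)
  obtain ⟨hlC, hlx⟩ := mem_erase_erase.1 hl
  exact ⟨l, hlC, by rwa [Function.update_of_ne hlx]⟩

/-- implication is invariant under the deletion reduct `·[x_ε]`
for formulas without tautological clauses. -/
theorem stmt1 (ψ φ : CNF) (hψ : noTaut ψ) (hφ : noTaut φ)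
    (x : Var) (hx : x ∈ varsCNF ψ ∪ varsCNF φ)
    (h : entails ψ φ) :
    entails (reduct1 ψ (x, none)) (reduct1 φ (x, none)) := by
  intro θ hθ D hD
  rw [mem_reduct1_none] at hD
  obtain ⟨C, hC, rfl⟩ := hD
  obtain ⟨l, hl, hval⟩ :=
    h _ (satCNF_update_of_reduct1_none (b := decide ((x, false) ∈ C)) hθ) C hC
  have hlx : l.1 ≠ x := by
    intro hlx
    obtain ⟨y, b⟩ := l
    obtain rfl : y = x := hlx
    have hC' := hφ C hC
    simp only [tautClause, not_exists, not_and] at hC'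
    have hCy := hC' y
    cases b <;> simp_all
  refine ⟨l, mem_erase_erase.2 ⟨hl, hlx⟩, ?_⟩
  rwa [Function.update_of_ne hlx] at hval
end

section
/- Let C be a clause-induced class of CNF formulas, ⟨W,D⟩ a CNF default theory, and B a set of variables of ⟨W,D⟩. Then B is a strong C-backdoor of ⟨W,D⟩ if and only if every formula occurring in the single reduct ⟨W,D⟩[Y_ε] belongs to C, where Y_ε = {x_ε : x ∈ B}. -/
/-- The literals of a clause whose variables are not in `L`. -/
def stripVars (L : List Var) (C : Clause) : Clause := C.filter (fun l => l.1 ∉ L)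

/-- Successive reducts of a formula, with the clauses of `u` conjoined after each step. -/
def reductAdd (u φ : CNF) (Y : List ELit) : CNF := Y.foldl (fun ψ e => reduct1 ψ e ∪ u) φ

theorem eq_stripVars_of_mem_reduct1 {φ : CNF} {e : ELit} {C' : Clause}
    (h : C' ∈ reduct1 φ e) : ∃ C ∈ φ, C' = stripVars [e.1] C := by
  obtain ⟨x, o⟩ := e
  cases o with
  | none =>
    simp only [reduct1, Finset.mem_image] at h
    obtain ⟨C, hC, rfl⟩ := h
    refine ⟨C, hC, ?_⟩
    ext ⟨z, b⟩
    cases b <;> simp [stripVars] <;> tauto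
  | some b =>
    simp only [reduct1, Finset.mem_image, Finset.mem_filter] at h
    obtain ⟨C, ⟨hC, hb⟩, rfl⟩ := h
    refine ⟨C, hC, ?_⟩
    ext ⟨z, c⟩
    simp only [stripVars, Finset.mem_erase, Finset.mem_filter, List.mem_singleton]
    by_cases hz : z = x
    · subst hz
      cases b <;> cases c <;> simp_all
    · simp [hz]

theorem stripVars_mem_reduct1 {φ : CNF} {C : Clause} (x : Var) (h : C ∈ φ) :
    stripVars [x] C ∈ reduct1 φ (x, none) := by
  simp only [reduct1, Finset.mem_image]
  refine ⟨C, h, ?_⟩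
  ext ⟨z, b⟩
  cases b <;> simp [stripVars] <;> tauto

theorem stripVars_cons (x : Var) (L : List Var) (C : Clause) :
    stripVars L (stripVars [x] C) = stripVars (x :: L) C := by
  ext l
  simp [stripVars, and_assoc]

theorem stripVars_eq_self {L : List Var} {C : Clause} (h : ∀ l ∈ C, l.1 ∉ L) :
    stripVars L C = C :=
  Finset.filter_true_of_mem h

theorem mem_reductAdd {u : CNF} {C' : Clause} (Y : List ELit) (φ : CNF)
    (hu : ∀ C ∈ u, ∀ l ∈ C, l.1 ∉ Y.map Prod.fst) (h : C' ∈ reductAdd u φ Y) :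
    (∃ C ∈ φ, C' = stripVars (Y.map Prod.fst) C) ∨ (Y ≠ [] ∧ C' ∈ u) := by
  induction Y generalizing φ with
  | nil => exact Or.inl ⟨C', h, (stripVars_eq_self (by simp)).symm⟩
  | cons e Y ih =>
    have hu' : ∀ C ∈ u, ∀ l ∈ C, l.1 ∉ Y.map Prod.fst := fun C hC l hl hm =>
      hu C hC l hl (List.mem_cons_of_mem _ hm)
    rcases ih (reduct1 φ e ∪ u) hu' h with ⟨C, hC, rfl⟩ | ⟨-, hC⟩
    · rcases Finset.mem_union.1 hC with hC | hC
      · obtain ⟨C, hCφ, rfl⟩ := eq_stripVars_of_mem_reduct1 hC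
        exact Or.inl ⟨C, hCφ, stripVars_cons _ _ _⟩
      · exact Or.inr ⟨by simp, by rwa [stripVars_eq_self (hu' C hC)]⟩
    · exact Or.inr ⟨by simp, hC⟩

theorem stripVars_mem_reductAdd {u : CNF} (L : List Var) {φ : CNF} {C : Clause} (h : C ∈ φ) :
    stripVars L C ∈ reductAdd u φ (L.map (fun x => ((x, none) : ELit))) := by
  induction L generalizing φ C with
  | nil => rwa [stripVars_eq_self (by simp)]
  | cons x L ih =>
    rw [← stripVars_cons]
    exact ih (Finset.mem_union_left _ (stripVars_mem_reduct1 x h))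

theorem mem_reductAdd_of_mem_added {u : CNF} {L : List Var} (hL : L ≠ []) (φ : CNF) {C : Clause}
    (hC : C ∈ u) (hCL : ∀ l ∈ C, l.1 ∉ L) :
    C ∈ reductAdd u φ (L.map (fun x => ((x, none) : ELit))) := by
  cases L with
  | nil => exact absurd rfl hL
  | cons x L =>
    have h := stripVars_mem_reductAdd (u := u) L
      (Finset.mem_union_right (reduct1 φ (x, none)) hC)
    rwa [stripVars_eq_self fun l hl hm => hCL l hl (List.mem_cons_of_mem _ hm)] at h

theorem subformula_reductAdd {u : CNF} {Y : List ELit} {L : List Var}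
    (hYL : ∀ x, x ∈ Y.map Prod.fst ↔ x ∈ L) (hu : ∀ C ∈ u, ∀ l ∈ C, l.1 ∉ L) (φ : CNF) :
    subformula (reductAdd u φ Y) (reductAdd u φ (L.map (fun x => ((x, none) : ELit)))) := by
  intro C' hC'
  rcases mem_reductAdd Y φ (fun C hC l hl hm => hu C hC l hl ((hYL _).1 hm)) hC' with
    ⟨C, hC, rfl⟩ | ⟨hY, hC⟩
  · have hs : stripVars (Y.map Prod.fst) C = stripVars L C := by
      simp only [stripVars, hYL]
    exact ⟨_, stripVars_mem_reductAdd L hC, hs.subset⟩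
  · have hL : L ≠ [] := by
      rintro rfl
      exact hY (List.map_eq_nil_iff.1 (List.eq_nil_iff_forall_not_mem.2 fun x hx => by
        simpa using (hYL x).1 hx))
    exact ⟨C', mem_reductAdd_of_mem_added hL φ hC (hu C' hC), subset_rfl⟩

theorem thReductL_eq (y : ℕ → Var) (T : DTheory) (Y : List ELit) :
    thReductL y T Y =
      ⟨T.W.image (fun ω => reductAdd ∅ ω Y),
       T.D.mapIdx (fun i d =>
         ⟨reductAdd ∅ d.pre Y, reductAdd ∅ d.just Y,
          reductAdd {({(y i, true)} : Clause)} d.concl Y⟩)⟩ := by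
  induction Y generalizing T with
  | nil =>
    obtain ⟨W, D⟩ := T
    simp only [thReductL, reductAdd, List.foldl_nil, Finset.image_id']
    congr 1
    refine List.ext_getElem List.length_mapIdx.symm fun i _ _ => ?_
    rw [List.getElem_mapIdx]
  | cons e Y ih =>
    have h : thReductL y T (e :: Y) = thReductL y (thReduct1 y T e) Y := rfl
    rw [h, ih]
    simp only [thReduct1, Finset.image_image, List.mapIdx_mapIdx, DTheory.mk.injEq]
    simp [reductAdd, addY, Function.comp_def]

theorem exists_subformula_thReductL {y : ℕ → Var} (T : DTheory) {Y : List ELit} {L : List Var}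
    (hYL : ∀ x, x ∈ Y.map Prod.fst ↔ x ∈ L) (hy : ∀ i, y i ∉ L) {φ : CNF}
    (hφ : φ ∈ thForms (thReductL y T Y)) :
    ∃ ψ ∈ thForms (thReductL y T (L.map (fun x => ((x, none) : ELit)))), subformula φ ψ := by
  rw [thReductL_eq] at hφ ⊢
  rcases hφ with hφ | ⟨d, hd, hφ⟩
  · obtain ⟨ω, hω, rfl⟩ := Finset.mem_image.1 (Finset.mem_coe.1 hφ)
    exact ⟨_, Or.inl (Finset.mem_coe.2 (Finset.mem_image_of_mem _ hω)),
      subformula_reductAdd hYL (by simp) ω⟩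
  · obtain ⟨i, hi, rfl⟩ := List.mem_mapIdx.1 hd
    have hmem := fun f : ℕ → DRule → DRule =>
      (List.mem_mapIdx (f := f) (l := T.D)).2 ⟨i, hi, rfl⟩
    rcases hφ with rfl | rfl | rfl
    · exact ⟨_, Or.inr ⟨_, hmem _, Or.inl rfl⟩, subformula_reductAdd hYL (by simp) _⟩
    · exact ⟨_, Or.inr ⟨_, hmem _, Or.inr (Or.inl rfl)⟩, subformula_reductAdd hYL (by simp) _⟩
    · exact ⟨_, Or.inr ⟨_, hmem _, Or.inr (Or.inr rfl)⟩,
        subformula_reductAdd hYL (by simpa using hy i) _⟩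

/-- for a clause-induced class `Cl`, `B` is a strong `Cl`-backdoor of
`⟨W,D⟩` iff every formula of the single reduct `⟨W,D⟩[Y_ε]` (with `Y_ε = {x_ε : x ∈ B}`)
belongs to `Cl`. -/
theorem stmt7 (Cl : Set CNF) (hCl : clauseInduced Cl)
    (T : DTheory) (y : ℕ → Var) (B : Finset Var)
    (hB : B ⊆ varsTheory T) (hy : freshFor y T B) :
    strongBackdoor y Cl T B ↔
      ∀ φ ∈ thForms (thReductL y T (B.toList.map (fun x => ((x, none) : ELit)))), φ ∈ Cl := by
  constructor
  · intro h
    refine h _ ⟨?_, ?_⟩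
    · simpa [Function.comp_def] using B.nodup_toList
    · simp [Function.comp_def]
  · intro h Y hY φ hφ
    obtain ⟨ψ, hψ, hsub⟩ := exists_subformula_thReductL T (L := B.toList)
      (fun x => by rw [← List.mem_toFinset, hY.2, Finset.mem_toList])
      (fun i hi => hy.2 i (Finset.mem_union_right _ (Finset.mem_toList.1 hi))) hφ
    exact hCl ψ (h ψ hψ) φ hsub
end

section
/- Let ⟨W,D⟩ be a CNF default theory, F = W ∪ {α, β, γ : α:β/γ ∈ D}, and let G⁺ be the graph on the variables of F in which two distinct variables x and y are joined by an edge if and only if some clause of some formula in F contains both positive literals x and y. Then a set B of variables of F is a strong HORN-backdoor of ⟨W,D⟩ if and only if B is a vertex cover of G⁺. -/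
theorem mem_reduct1_subset {φ : CNF} {e : ELit} {C : Clause} (hC : C ∈ reduct1 φ e) :
    ∃ C₀ ∈ φ, C ⊆ C₀ ∧ ∀ l ∈ C, l.1 ≠ e.1 := by
  obtain ⟨x, o⟩ := e
  cases o with
  | none =>
    simp only [reduct1, Finset.mem_image] at hC
    obtain ⟨C₀, h₀, rfl⟩ := hC
    refine ⟨C₀, h₀, (Finset.erase_subset _ _).trans (Finset.erase_subset _ _), ?_⟩
    rintro ⟨z, b⟩ hl rfl
    cases b <;> simp at hl
  | some b =>
    simp only [reduct1, Finset.mem_image, Finset.mem_filter] at hC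
    obtain ⟨C₀, ⟨h₀, hb⟩, rfl⟩ := hC
    refine ⟨C₀, h₀, Finset.erase_subset _ _, ?_⟩
    rintro ⟨z, b'⟩ hl rfl
    cases b <;> cases b' <;> simp_all

theorem exists_mem_reduct1_none {φ : CNF} {C : Clause} (hC : C ∈ φ) (x : Var) :
    ∃ C' ∈ reduct1 φ (x, none), ∀ l ∈ C, l.1 ≠ x → l ∈ C' := by
  refine ⟨_, Finset.mem_image_of_mem _ hC, fun l hl hx => ?_⟩
  simp only [Finset.mem_erase]
  exact ⟨fun h => hx (by rw [h]), fun h => hx (by rw [h]), hl⟩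

theorem mem_thReduct1_subset {y : ℕ → Var} {T : DTheory} {e : ELit} {φ : CNF}
    (hφ : φ ∈ thForms (thReduct1 y T e)) {C : Clause} (hC : C ∈ φ) :
    (∃ φ₀ ∈ thForms T, ∃ C₀ ∈ φ₀, C ⊆ C₀ ∧ ∀ l ∈ C, l.1 ≠ e.1) ∨ C.card ≤ 1 := by
  rcases hφ with hW | ⟨d, hd, hφ⟩
  · simp only [thReduct1, Finset.coe_image, Set.mem_image] at hW
    obtain ⟨ω, hω, rfl⟩ := hW
    exact Or.inl ⟨ω, Or.inl hω, mem_reduct1_subset hC⟩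
  · simp only [thReduct1, List.mem_mapIdx] at hd
    obtain ⟨i, hi, rfl⟩ := hd
    have hm := List.getElem_mem hi
    rcases hφ with rfl | rfl | rfl
    · exact Or.inl ⟨_, Or.inr ⟨_, hm, Or.inl rfl⟩, mem_reduct1_subset hC⟩
    · exact Or.inl ⟨_, Or.inr ⟨_, hm, Or.inr (Or.inl rfl)⟩, mem_reduct1_subset hC⟩
    · rcases Finset.mem_union.mp hC with hC | hC
      · exact Or.inl ⟨_, Or.inr ⟨_, hm, Or.inr (Or.inr rfl)⟩, mem_reduct1_subset hC⟩
      · rw [Finset.mem_singleton.mp hC]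
        exact Or.inr (Finset.card_singleton _).le

theorem exists_mem_thReduct1 (y : ℕ → Var) {T : DTheory} {φ : CNF} (hφ : φ ∈ thForms T)
    (e : ELit) : ∃ φ' ∈ thForms (thReduct1 y T e), reduct1 φ e ⊆ φ' := by
  rcases hφ with hW | ⟨d, hd, hφ⟩
  · exact ⟨_, Or.inl (Finset.mem_coe.mpr (Finset.mem_image_of_mem _ hW)), Finset.Subset.refl _⟩
  · obtain ⟨i, hi, rfl⟩ := List.getElem_of_mem hd
    have hm : (⟨reduct1 T.D[i].pre e, reduct1 T.D[i].just e,
        addY (reduct1 T.D[i].concl e) (y i)⟩ : DRule) ∈ (thReduct1 y T e).D :=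
      List.mem_mapIdx.mpr ⟨i, hi, rfl⟩
    rcases hφ with rfl | rfl | rfl
    · exact ⟨_, Or.inr ⟨_, hm, Or.inl rfl⟩, Finset.Subset.refl _⟩
    · exact ⟨_, Or.inr ⟨_, hm, Or.inr (Or.inl rfl)⟩, Finset.Subset.refl _⟩
    · exact ⟨_, Or.inr ⟨_, hm, Or.inr (Or.inr rfl)⟩, Finset.subset_union_left⟩

theorem mem_thReductL_subset {y : ℕ → Var} (Y : List ELit) {T : DTheory} {φ : CNF}
    (hφ : φ ∈ thForms (thReductL y T Y)) {C : Clause} (hC : C ∈ φ) :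
    (∃ φ₀ ∈ thForms T, ∃ C₀ ∈ φ₀, C ⊆ C₀ ∧ ∀ l ∈ C, l.1 ∉ Y.map Prod.fst) ∨ C.card ≤ 1 := by
  induction Y generalizing T with
  | nil => exact Or.inl ⟨φ, hφ, C, hC, Finset.Subset.refl _, by simp⟩
  | cons e Y ih =>
    rcases ih (T := thReduct1 y T e) hφ with ⟨φ₁, hφ₁, C₁, hC₁, hsub, hY⟩ | h
    · rcases mem_thReduct1_subset hφ₁ hC₁ with ⟨φ₀, hφ₀, C₀, hC₀, hsub₀, he⟩ | h
      · refine Or.inl ⟨φ₀, hφ₀, C₀, hC₀, hsub.trans hsub₀, fun l hl => ?_⟩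
        rw [List.map_cons, List.mem_cons, not_or]
        exact ⟨he l (hsub hl), hY l hl⟩
      · exact Or.inr ((Finset.card_le_card hsub).trans h)
    · exact Or.inr h

theorem exists_mem_thReductL_none (y : ℕ → Var) (X : List Var) {T : DTheory} {φ : CNF}
    (hφ : φ ∈ thForms T) {C : Clause} (hC : C ∈ φ) :
    ∃ φ' ∈ thForms (thReductL y T (X.map fun x => (x, none))),
      ∃ C' ∈ φ', ∀ l ∈ C, l.1 ∉ X → l ∈ C' := by
  induction X generalizing T φ C with
  | nil => exact ⟨φ, hφ, C, hC, fun l hl _ => hl⟩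
  | cons x X ih =>
    obtain ⟨C₁, hC₁, h₁⟩ := exists_mem_reduct1_none hC x
    obtain ⟨φ₁, hφ₁, hsub⟩ := exists_mem_thReduct1 y hφ (x, none)
    obtain ⟨φ', hφ', C', hC', h'⟩ := ih hφ₁ (hsub hC₁)
    refine ⟨φ', hφ', C', hC', fun l hl hX => ?_⟩
    rw [List.mem_cons, not_or] at hX
    exact h' l (h₁ l hl hX.1) hX.2

theorem isTAList_map_none (B : Finset Var) :
    isTAList B (B.toList.map fun x => (x, none)) := by
  have h : (B.toList.map fun x => ((x, none) : ELit)).map Prod.fst = B.toList := by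
    rw [List.map_map]
    exact List.map_id _
  rw [isTAList, h]
  exact ⟨B.nodup_toList, B.toList_toFinset⟩

/-- `B` is a strong HORN-backdoor of `⟨W,D⟩` iff `B` is a vertex cover of
the graph `G⁺` on the variables of `F` joining distinct `u, v` whenever some clause of a
formula in `F` contains both positive literals `u` and `v`. -/
theorem stmt9 (T : DTheory) (y : ℕ → Var) (B : Finset Var)
    (hB : B ⊆ varsTheory T) (hy : freshFor y T B) :
    strongBackdoor y {φ | hornCNF φ} T B ↔
      ∀ u v : Var, u ≠ v →
        (∃ φ ∈ thForms T, ∃ C ∈ φ, (u, true) ∈ C ∧ (v, true) ∈ C) →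
        (u ∈ B ∨ v ∈ B) := by
  constructor
  · rintro h u v huv ⟨φ, hφ, C, hC, hu, hv⟩
    by_contra! hB'
    obtain ⟨φ', hφ', C', hC', h'⟩ := exists_mem_thReductL_none y B.toList hφ hC
    have huC := h' _ hu (by simpa using hB'.1)
    have hvC := h' _ hv (by simpa using hB'.2)
    exact huv (congrArg Prod.fst
      (h _ (isTAList_map_none B) φ' hφ' C' hC' _ huC _ hvC rfl rfl))
  · intro h Y hY φ hφ C hC l hl l' hl' hp hp'
    rcases mem_thReductL_subset Y hφ hC with ⟨φ₀, hφ₀, C₀, hC₀, hsub, hnot⟩ | hcard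
    · by_contra hne
      obtain ⟨u, b⟩ := l
      obtain ⟨v, b'⟩ := l'
      obtain rfl : b = true := hp
      obtain rfl : b' = true := hp'
      have hnotB : ∀ l ∈ C, l.1 ∉ B := fun l hl hlB =>
        hnot l hl (by rwa [← List.mem_toFinset, hY.2])
      rcases h u v (fun huv => hne (by rw [huv]))
        ⟨φ₀, hφ₀, C₀, hC₀, hsub hl, hsub hl'⟩ with hB' | hB'
      · exact hnotB _ hl hB'
      · exact hnotB _ hl' hB'
    · exact Finset.card_le_one.mp hcard l hl l' hl'
end

section
/- Let ⟨W,D⟩ be a CNF default theory whose formulas contain no tautological clauses, F = W ∪ {α, β, γ : α:β/γ ∈ D}, and let H be the hypergraph on the variables of F whose hyperedges are the sets {x,y,z} of three distinct variables such that some clause of some formula in F contains literals over all of x, y, and z. Then a set B of variables of F is a strong KROM-backdoor of ⟨W,D⟩ if and only if B is a 3-hitting set of H (i.e., B intersects every hyperedge of H). -/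
theorem exists_superset_of_mem_reduct1 {φ : CNF} {e : ELit} {C' : Clause}
    (h : C' ∈ reduct1 φ e) : ∃ C ∈ φ, C' ⊆ C ∧ ∀ l ∈ C', l.1 ≠ e.1 := by
  obtain ⟨x, _ | b⟩ := e
  · simp only [reduct1, Finset.mem_image] at h
    obtain ⟨C, hC, rfl⟩ := h
    refine ⟨C, hC, fun l hl => by simp_all, ?_⟩
    rintro ⟨z, c⟩ hl rfl
    cases c <;> simp at hl
  · simp only [reduct1, Finset.mem_image, Finset.mem_filter] at h
    obtain ⟨C, ⟨hC, hb⟩, rfl⟩ := h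
    refine ⟨C, hC, Finset.erase_subset _ _, ?_⟩
    rintro ⟨z, c⟩ hl rfl
    cases b <;> cases c <;> simp_all

theorem mem_of_mem_thForms_thReduct1 {y : ℕ → Var} {T : DTheory} {e : ELit} {φ' : CNF}
    {C' : Clause} (hφ : φ' ∈ thForms (thReduct1 y T e)) (hC : C' ∈ φ') :
    C'.card ≤ 1 ∨ ∃ φ ∈ thForms T, C' ∈ reduct1 φ e := by
  rcases hφ with h | ⟨d, hd, h⟩
  · simp only [thReduct1, Finset.coe_image, Set.mem_image] at h
    obtain ⟨φ, hφ, rfl⟩ := h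
    exact .inr ⟨φ, .inl hφ, hC⟩
  · simp only [thReduct1, List.mem_mapIdx] at hd
    obtain ⟨i, hi, rfl⟩ := hd
    have hm := List.getElem_mem hi
    rcases h with rfl | rfl | rfl
    · exact .inr ⟨_, .inr ⟨_, hm, .inl rfl⟩, hC⟩
    · exact .inr ⟨_, .inr ⟨_, hm, .inr (.inl rfl)⟩, hC⟩
    · rcases Finset.mem_union.1 hC with hC | hC
      · exact .inr ⟨_, .inr ⟨_, hm, .inr (.inr rfl)⟩, hC⟩
      · rw [Finset.mem_singleton] at hC
        simp [hC]

theorem exists_reduct1_subset_mem_thForms (y : ℕ → Var) {T : DTheory} (e : ELit) {φ : CNF}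
    (hφ : φ ∈ thForms T) : ∃ φ' ∈ thForms (thReduct1 y T e), reduct1 φ e ⊆ φ' := by
  rcases hφ with h | ⟨d, hd, h⟩
  · exact ⟨_, .inl (Finset.mem_coe.2 (Finset.mem_image_of_mem _ h)), subset_rfl⟩
  · obtain ⟨i, hi, rfl⟩ := List.getElem_of_mem hd
    have hm : (⟨reduct1 T.D[i].pre e, reduct1 T.D[i].just e,
        addY (reduct1 T.D[i].concl e) (y i)⟩ : DRule) ∈ (thReduct1 y T e).D :=
      List.mem_mapIdx.2 ⟨i, hi, rfl⟩
    rcases h with rfl | rfl | rfl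
    · exact ⟨_, .inr ⟨_, hm, .inl rfl⟩, subset_rfl⟩
    · exact ⟨_, .inr ⟨_, hm, .inr (.inl rfl)⟩, subset_rfl⟩
    · exact ⟨_, .inr ⟨_, hm, .inr (.inr rfl)⟩, Finset.subset_union_left⟩

theorem exists_superset_of_mem_thReductL (y : ℕ → Var) (Y : List ELit) (T : DTheory)
    {φ' : CNF} {C' : Clause} (hφ : φ' ∈ thForms (thReductL y T Y)) (hC : C' ∈ φ') :
    C'.card ≤ 1 ∨ ∃ φ ∈ thForms T, ∃ C ∈ φ, C' ⊆ C ∧ ∀ l ∈ C', l.1 ∉ Y.map Prod.fst := by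
  induction Y generalizing T with
  | nil => exact .inr ⟨φ', hφ, C', hC, subset_rfl, by simp⟩
  | cons e Y ih =>
    rcases ih (thReduct1 y T e) hφ with h | ⟨φ₁, hφ₁, C₁, hC₁, hsub, hY⟩
    · exact .inl h
    · rcases mem_of_mem_thForms_thReduct1 hφ₁ hC₁ with h | ⟨φ, hφ, h⟩
      · exact .inl ((Finset.card_le_card hsub).trans h)
      · obtain ⟨C, hC, hCsub, he⟩ := exists_superset_of_mem_reduct1 h
        refine .inr ⟨φ, hφ, C, hC, hsub.trans hCsub, fun l hl => ?_⟩
        rw [List.map_cons, List.mem_cons, not_or]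
        exact ⟨he l (hsub hl), hY l hl⟩

theorem exists_mem_thReductL_epsilon (y : ℕ → Var) (X : List Var) (T : DTheory)
    {φ : CNF} {C : Clause} (hφ : φ ∈ thForms T) (hC : C ∈ φ) :
    ∃ φ' ∈ thForms (thReductL y T (X.map fun x => (x, none))), ∃ C' ∈ φ',
      ∀ l ∈ C, l.1 ∉ X → l ∈ C' := by
  induction X generalizing T φ C with
  | nil => exact ⟨φ, hφ, C, hC, fun l hl _ => hl⟩
  | cons x X ih =>
    obtain ⟨φ₁, hφ₁, hsub⟩ := exists_reduct1_subset_mem_thForms y (x, none) hφ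
    obtain ⟨φ', hφ', C', hC', h⟩ := ih (thReduct1 y T (x, none)) hφ₁
      (hsub (Finset.mem_image_of_mem (fun C : Clause => (C.erase (x, true)).erase (x, false)) hC))
    refine ⟨φ', hφ', C', hC', fun l hl hX => ?_⟩
    rw [List.mem_cons, not_or] at hX
    refine h l ?_ hX.2
    rw [Finset.mem_erase, Finset.mem_erase]
    exact ⟨fun h => hX.1 (by rw [h]), fun h => hX.1 (by rw [h]), hl⟩

theorem fst_ne_of_not_tautClause {C : Clause} (h : ¬ tautClause C) {l l' : Lit}
    (hl : l ∈ C) (hl' : l' ∈ C) (hne : l ≠ l') : l.1 ≠ l'.1 := by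
  obtain ⟨x, b⟩ := l
  obtain ⟨x', b'⟩ := l'
  rintro rfl
  refine h ⟨x, ?_⟩
  cases b <;> cases b' <;> simp_all

/-- for theories without tautological clauses, `B` is a strong
KROM-backdoor of `⟨W,D⟩` iff `B` is a 3-hitting set of the hypergraph whose hyperedges
are the triples of distinct variables occurring together in some clause of a formula of
`F = W ∪ {α,β,γ : α:β/γ ∈ D}`. -/
theorem stmt10 (T : DTheory) (y : ℕ → Var) (B : Finset Var)
    (hnt : ∀ φ ∈ thForms T, noTaut φ)
    (hB : B ⊆ varsTheory T) (hy : freshFor y T B) :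
    strongBackdoor y {φ | kromCNF φ} T B ↔
      ∀ u v w : Var, u ≠ v → u ≠ w → v ≠ w →
        (∃ φ ∈ thForms T, ∃ C ∈ φ,
          u ∈ varsClause C ∧ v ∈ varsClause C ∧ w ∈ varsClause C) →
        (u ∈ B ∨ v ∈ B ∨ w ∈ B) := by
  constructor
  · rintro hs u v w huv huw hvw ⟨φ, hφ, C, hC, hu, hv, hw⟩
    by_contra! hn
    obtain ⟨φ', hφ', C', hC', h⟩ := exists_mem_thReductL_epsilon y B.toList T hφ hC
    have hk : kromCNF φ' := hs _ ⟨by simpa [Function.comp_def] using B.nodup_toList,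
      by simp [Function.comp_def]⟩ φ' hφ'
    have hvars : ∀ x ∈ varsClause C, x ∉ B → x ∈ varsClause C' := by
      intro x hx hxB
      obtain ⟨l, hl, rfl⟩ := Finset.mem_image.1 hx
      exact Finset.mem_image_of_mem _ (h l hl (by simpa using hxB))
    have hcard : 2 < (varsClause C').card :=
      Finset.two_lt_card.2 ⟨u, hvars u hu hn.1, v, hvars v hv hn.2.1, w, hvars w hw hn.2.2,
        huv, huw, hvw⟩
    exact absurd (hcard.trans_le Finset.card_image_le) (not_lt.2 (hk C' hC'))
  · intro hhit Y hY φ' hφ' C' hC'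
    by_contra! hcard
    rcases exists_superset_of_mem_thReductL y Y T hφ' hC' with h | ⟨φ, hφ, C, hC, hsub, hd⟩
    · omega
    obtain ⟨a, ha, b, hb, c, hc, hab, hac, hbc⟩ := Finset.two_lt_card.1 hcard
    have hne := fun {l l'} => fst_ne_of_not_tautClause (hnt φ hφ C hC) (l := l) (l' := l')
    have hB' : ∀ l ∈ C', l.1 ∉ B := fun l hl hlB =>
      hd l hl (List.mem_toFinset.1 (hY.2.symm ▸ hlB))
    have hvar : ∀ l ∈ C', l.1 ∈ varsClause C := fun l hl => Finset.mem_image_of_mem _ (hsub hl)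
    rcases hhit a.1 b.1 c.1 (hne (hsub ha) (hsub hb) hab) (hne (hsub ha) (hsub hc) hac)
      (hne (hsub hb) (hsub hc) hbc) ⟨φ, hφ, C, hC, hvar a ha, hvar b hb, hvar c hc⟩ with h | h | h
    exacts [hB' a ha h, hB' b hb h, hB' c hc h]
end

section
/- Let ⟨W,D⟩ be a default theory and let E be a stable extension of ⟨W,D⟩. Let G = {α:β/γ ∈ D : α ∈ E and ¬β ∉ E} be the set of generating defaults of E. Then E = Th(W ∪ {γ : α:β/γ ∈ G}). -/
theorem subset_Th (Φ : Set CNF) : Φ ⊆ Th Φ := fun _ hψ _ hθ => hθ _ hψ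

theorem Th_mono {Φ Ψ : Set CNF} (h : Φ ⊆ Ψ) : Th Φ ⊆ Th Ψ :=
  fun _ hψ θ hθ => hψ θ fun φ hφ => hθ φ (h hφ)

theorem Th_Th (Φ : Set CNF) : Th (Th Φ) = Th Φ :=
  Set.Subset.antisymm (fun _ hψ θ hθ => hψ θ fun _ hφ => hφ θ hθ) (subset_Th _)

/-- `Γ(E)` itself satisfies the closure conditions of which it is the least solution. -/
theorem closedFor_Gamma (T : DTheory) (E : Set CNF) : closedFor T E (Gamma T E) := by
  refine ⟨fun φ hφ S hS => hS.1 hφ, Set.Subset.antisymm (fun ψ hψ S hS => ?_) (subset_Th _),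
    fun d hd hpre hjust S hS => hS.2.2 d hd (hpre S hS) hjust⟩
  rw [← hS.2.1]
  exact Th_mono (Set.sInter_subset_of_mem hS) hψ

/-- if `E` is a stable extension of `⟨W,D⟩` and `G` its set of
generating defaults, then `E = Th(W ∪ {γ : α:β/γ ∈ G})`. -/
theorem stmt13 (T : DTheory) (E : Set CNF) (hE : stableExt T E) :
    E = Th ((↑T.W : Set CNF) ∪
      {γ | ∃ d ∈ T.D, d.pre ∈ E ∧ notViolated E d.just ∧ γ = d.concl}) := by
  obtain ⟨hW, hTh, hD⟩ : closedFor T E E := by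
    have h := closedFor_Gamma T E
    rwa [show Gamma T E = E from hE] at h
  have hsub : Th ((↑T.W : Set CNF) ∪
      {γ | ∃ d ∈ T.D, d.pre ∈ E ∧ notViolated E d.just ∧ γ = d.concl}) ⊆ E := by
    rw [← hTh]
    refine Th_mono ?_
    rw [hTh]
    refine Set.union_subset hW ?_
    rintro _ ⟨d, hd, hpre, hjust, rfl⟩
    exact hD d hd hpre hjust
  refine Set.Subset.antisymm ?_ hsub
  have hleast : Gamma T E ⊆ Th ((↑T.W : Set CNF) ∪
      {γ | ∃ d ∈ T.D, d.pre ∈ E ∧ notViolated E d.just ∧ γ = d.concl}) :=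
    Set.sInter_subset_of_mem ⟨Set.subset_union_left.trans (subset_Th _), Th_Th _,
      fun d hd hpre hjust => subset_Th _ (Or.inr ⟨d, hd, hsub hpre, hjust, rfl⟩)⟩
  rwa [show Gamma T E = E from hE] at hleast
end

section
/- Let ⟨W,D⟩ be a default theory and E a set of CNF formulas with E = Th(E). Let D' = {α:γ : α:β/γ ∈ D, E ⊭ ¬β} be the justification-free rules whose justifications are not violated by E, and let E' be the least set of formulas containing W and closed under the rules of D' (i.e., whenever E' ⊨ α for some α:γ ∈ D', then γ ∈ E'). Then E is a stable extension of ⟨W,D⟩ if and only if E ⊨ E' and E' ⊨ E (i.e., Th(E) = Th(E')). -/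
/-- The least set of formulas containing `W` and closed under the justification-free
rules `{α:γ : α:β/γ ∈ D, E ⊭ ¬β}`: whenever it entails `α`, it contains `γ`. -/
def leastClosedJF (T : DTheory) (E : Set CNF) : Set CNF :=
  ⋂₀ {S : Set CNF | (↑T.W : Set CNF) ⊆ S ∧
      ∀ d ∈ T.D, notViolated E d.just → entailsSet S d.pre → d.concl ∈ S}

theorem W_subset_leastClosedJF (T : DTheory) (E : Set CNF) :
    (↑T.W : Set CNF) ⊆ leastClosedJF T E :=
  Set.subset_sInter fun _ hS => hS.1

theorem concl_mem_leastClosedJF {T : DTheory} {E : Set CNF} {d : DRule} (hd : d ∈ T.D)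
    (hj : notViolated E d.just) (hp : entailsSet (leastClosedJF T E) d.pre) :
    d.concl ∈ leastClosedJF T E :=
  fun _ hS => hS.2 d hd hj (Th_mono (Set.sInter_subset_of_mem hS) hp)

theorem closedFor_Th_leastClosedJF (T : DTheory) (E : Set CNF) :
    closedFor T E (Th (leastClosedJF T E)) :=
  ⟨(W_subset_leastClosedJF T E).trans (subset_Th _), Th_Th _,
    fun _ hd hp hj => subset_Th _ (concl_mem_leastClosedJF hd hj hp)⟩

theorem leastClosedJF_subset_of_closedFor {T : DTheory} {E S : Set CNF} (hS : closedFor T E S) :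
    leastClosedJF T E ⊆ S :=
  Set.sInter_subset_of_mem
    ⟨hS.1, fun d hd hj hp => hS.2.2 d hd (hS.2.1.subset hp) hj⟩

theorem Gamma_eq_Th_leastClosedJF (T : DTheory) (E : Set CNF) :
    Gamma T E = Th (leastClosedJF T E) :=
  Set.Subset.antisymm (Set.sInter_subset_of_mem (closedFor_Th_leastClosedJF T E))
    (Set.subset_sInter fun _ hS =>
      (Th_mono (leastClosedJF_subset_of_closedFor hS)).trans hS.2.1.subset)

/-- for deductively closed `E`, `E` is a stable extension of `⟨W,D⟩` iff
`E ⊨ E'` and `E' ⊨ E`, where `E'` is the least set containing `W` closed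
under the unviolated justification-free rules. -/
theorem stmt17 (T : DTheory) (E : Set CNF) (hE : Th E = E) :
    stableExt T E ↔
      ((∀ φ ∈ leastClosedJF T E, entailsSet E φ) ∧
       (∀ φ ∈ E, entailsSet (leastClosedJF T E) φ)) := by
  rw [stableExt, Gamma_eq_Th_leastClosedJF]
  constructor
  · intro h
    exact ⟨fun φ hφ => subset_Th E (h.subset (subset_Th _ hφ)), fun _ hφ => h.symm.subset hφ⟩
  · rintro ⟨hL, hE'⟩
    refine Set.Subset.antisymm ?_ hE'
    have hsub : leastClosedJF T E ⊆ E := fun φ hφ => hE.subset (hL φ hφ)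
    exact (Th_mono hsub).trans hE.subset
end
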